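/- arXiv:1501.00159 — 3 statements merged into one kernel-verified Lean document; each statement's English description precedes it below -/
import Mathlib

section
/- Let S be a rational set in the plane, let c be a point of S, and let r be a positive rational number. Let ι denote the inversion with center c and radius r, i.e. ι(p) = c + (r²/‖p−c‖²)·(p−c) for p ≠ c. Then the image ι(S \ {c}) is again a rational set. -/
/-- The inversion with center `c` and radius `r`:  `p ↦ c + (r²/‖p−c‖²)·(p−c)`. -/
noncomputable def planeInversion (c : EuclideanSpace ℝ (Fin 2)) (r : ℝ) :
    EuclideanSpace ℝ (Fin 2) → EuclideanSpace ℝ (Fin 2) :=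
  fun p => c + (r ^ 2 / ‖p - c‖ ^ 2) • (p - c)

/-- If we apply inversion to a rational set `S`, with center `c ∈ S` and a positive
rational radius `r`, then the image of `S \ {c}` is again a rational set. -/
theorem inversion_image_of_rationalSet (S : Set (EuclideanSpace ℝ (Fin 2)))
    (hS : ∀ p ∈ S, ∀ q ∈ S, ∃ d : ℚ, dist p q = (d : ℝ))
    (c : EuclideanSpace ℝ (Fin 2)) (hc : c ∈ S) (r : ℚ) (hr : 0 < r) :
    ∀ p ∈ planeInversion c (r : ℝ) '' (S \ {c}),
      ∀ q ∈ planeInversion c (r : ℝ) '' (S \ {c}),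
        ∃ d : ℚ, dist p q = (d : ℝ) := by
  rintro _ ⟨x, ⟨hxS, hx⟩, rfl⟩ _ ⟨y, ⟨hyS, hy⟩, rfl⟩
  have key : ∀ z, planeInversion c (r : ℝ) z = EuclideanGeometry.inversion c (r : ℝ) z := by
    intro z
    simp only [planeInversion, EuclideanGeometry.inversion, vsub_eq_sub, vadd_eq_add,
      dist_eq_norm, div_pow]
    exact add_comm _ _
  obtain ⟨a, ha⟩ := hS x hxS c hc
  obtain ⟨b, hb⟩ := hS y hyS c hc
  obtain ⟨d, hd⟩ := hS x hxS y hyS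
  refine ⟨r ^ 2 / (a * b) * d, ?_⟩
  rw [key, key, EuclideanGeometry.dist_inversion_inversion hx hy, ha, hb, hd]
  push_cast
  rfl
end

section
/- Let S be an infinite subset of the plane ℝ² such that the Euclidean distance between any two points of S is an integer. Then S is contained in a line; that is, all points of S are collinear. -/
open Polynomial in
theorem ae_fin (b1 b2 c1 c2 k l : ℝ) (hD : b1 * c2 - b2 * c1 ≠ 0) :
    {p : ℝ × ℝ | ∃ r : ℝ, p.1 ^ 2 + p.2 ^ 2 = r ^ 2 ∧
      (p.1 - b1) ^ 2 + (p.2 - b2) ^ 2 = (r - k) ^ 2 ∧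
      (p.1 - c1) ^ 2 + (p.2 - c2) ^ 2 = (r - l) ^ 2}.Finite := by
  obtain ⟨D, hDd⟩ : ∃ D, D = b1 * c2 - b2 * c1 := ⟨_, rfl⟩
  obtain ⟨b0, hb0⟩ : ∃ x, x = (b1 ^ 2 + b2 ^ 2 - k ^ 2) / 2 := ⟨_, rfl⟩
  obtain ⟨c0, hc0⟩ : ∃ x, x = (c1 ^ 2 + c2 ^ 2 - l ^ 2) / 2 := ⟨_, rfl⟩
  obtain ⟨u1, hu1⟩ : ∃ x, x = k * c2 - l * b2 := ⟨_, rfl⟩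
  obtain ⟨u2, hu2⟩ : ∃ x, x = b1 * l - c1 * k := ⟨_, rfl⟩
  obtain ⟨v1, hv1⟩ : ∃ x, x = b0 * c2 - c0 * b2 := ⟨_, rfl⟩
  obtain ⟨v2, hv2⟩ : ∃ x, x = b1 * c0 - c1 * b0 := ⟨_, rfl⟩
  rw [← hDd] at hD
  let q : ℝ[X] := C (u1 ^ 2 + u2 ^ 2 - D ^ 2) * X ^ 2 + C (2 * (u1 * v1 + u2 * v2)) * X
    + C (v1 ^ 2 + v2 ^ 2)
  have hq : q ≠ 0 := by
    intro h
    have h0 : v1 ^ 2 + v2 ^ 2 = 0 := by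
      have := congrArg (fun p => coeff p 0) h
      simpa [q, -map_add, -map_sub, -map_pow, -map_mul] using this
    have h2 : u1 ^ 2 + u2 ^ 2 - D ^ 2 = 0 := by
      have := congrArg (fun p => coeff p 2) h
      simpa [q, coeff_X, coeff_C, -map_add, -map_sub, -map_pow, -map_mul] using this
    have e1 : v1 = 0 := by nlinarith [sq_nonneg v1, sq_nonneg v2]
    have e2 : v2 = 0 := by nlinarith [sq_nonneg v1, sq_nonneg v2]
    have f1 : b0 = 0 := by
      have : D * b0 = 0 := by rw [hDd]; linear_combination b1 * e1 + b2 * e2 - b1 * hv1 - b2 * hv2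
      exact (mul_eq_zero.1 this).resolve_left hD
    have f2 : c0 = 0 := by
      have : D * c0 = 0 := by rw [hDd]; linear_combination c1 * e1 + c2 * e2 - c1 * hv1 - c2 * hv2
      exact (mul_eq_zero.1 this).resolve_left hD
    have g1 : b1 ^ 2 + b2 ^ 2 = k ^ 2 := by linarith
    have g2 : c1 ^ 2 + c2 ^ 2 = l ^ 2 := by linarith
    have hDD : D ^ 2 = k ^ 2 * l ^ 2 - (b1 * c1 + b2 * c2) ^ 2 := by
      rw [← g1, ← g2, hDd]; ring
    have huu : u1 ^ 2 + u2 ^ 2 = 2 * k ^ 2 * l ^ 2 - 2 * k * l * (b1 * c1 + b2 * c2) := by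
      rw [hu1, hu2]; linear_combination k ^ 2 * g2 + l ^ 2 * g1
    have h3 : (k * l - (b1 * c1 + b2 * c2)) ^ 2 = 0 := by
      linear_combination h2 - huu + hDD
    have h4 : k * l - (b1 * c1 + b2 * c2) = 0 := pow_eq_zero_iff (two_ne_zero) |>.1 h3
    have h5 : D ^ 2 = 0 := by
      rw [hDD]; linear_combination (k * l + (b1 * c1 + b2 * c2)) * h4
    exact hD (pow_eq_zero_iff (two_ne_zero) |>.1 h5)
  refine ((finite_setOfPred_isRoot hq).image
    (fun r => ((r * u1 + v1) / D, (r * u2 + v2) / D))).subset ?_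
  rintro ⟨x, y⟩ ⟨r, h1, h2, h3⟩
  simp only at h1 h2 h3
  have hx : D * x = r * u1 + v1 := by
    rw [hDd, hu1, hv1, hb0, hc0]
    linear_combination (c2 / 2 - b2 / 2) * h1 - c2 / 2 * h2 + b2 / 2 * h3
  have hy : D * y = r * u2 + v2 := by
    rw [hDd, hu2, hv2, hb0, hc0]
    linear_combination (b1 / 2 - c1 / 2) * h1 + c1 / 2 * h2 - b1 / 2 * h3
  refine ⟨r, ?_, ?_⟩
  · simp only [Set.mem_ofPred_eq, IsRoot.def, q]
    simp only [eval_add, eval_mul, eval_C, eval_pow, eval_X]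
    linear_combination D ^ 2 * h1 - (D * x + (r * u1 + v1)) * hx - (D * y + (r * u2 + v2)) * hy
  · simp only [← hx, ← hy]
    rw [mul_div_cancel_left₀ _ hD, mul_div_cancel_left₀ _ hD]

theorem ae_dist (p q : EuclideanSpace ℝ (Fin 2)) :
    dist p q ^ 2 = (p 0 - q 0) ^ 2 + (p 1 - q 1) ^ 2 := by
  rw [EuclideanSpace.dist_eq, Real.sq_sqrt (by positivity)]
  simp [Fin.sum_univ_two, Real.dist_eq]

theorem ae_fin2 (A B C : EuclideanSpace ℝ (Fin 2)) (k l : ℝ)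
    (hD : (B 0 - A 0) * (C 1 - A 1) - (B 1 - A 1) * (C 0 - A 0) ≠ 0) :
    {P : EuclideanSpace ℝ (Fin 2) | dist P A - dist P B = k ∧ dist P A - dist P C = l}.Finite := by
  refine Set.Finite.of_finite_image (f := fun P => ((P 0 - A 0, P 1 - A 1) : ℝ × ℝ))
    ((ae_fin _ _ _ _ k l hD).subset ?_) ?_
  · rintro _ ⟨P, ⟨h1, h2⟩, rfl⟩
    refine ⟨dist P A, (ae_dist P A).symm, ?_, ?_⟩
    · rw [← h1, sub_sub_cancel, ae_dist]; ring
    · rw [← h2, sub_sub_cancel, ae_dist]; ring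
  · intro P _ Q _ h
    simp only [Prod.mk.injEq, sub_left_inj] at h
    ext i
    fin_cases i
    · exact h.1
    · exact h.2

/-- (Anning–Erdős) An infinite subset of the plane with all pairwise distances
integers is contained in a line. -/
theorem anning_erdos (S : Set (EuclideanSpace ℝ (Fin 2))) (hinf : S.Infinite)
    (hS : ∀ p ∈ S, ∀ q ∈ S, ∃ n : ℤ, dist p q = (n : ℝ)) :
    Collinear ℝ S := by
  obtain ⟨A, hA⟩ := hinf.nonempty
  obtain ⟨B, hB, hBA⟩ := hinf.exists_notMem_finite (Set.finite_singleton A)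
  have hBA' : B ≠ A := fun h => hBA h
  rw [collinear_iff_of_mem hA]
  refine ⟨B - A, fun C hC => ?_⟩
  have hn : (B 0 - A 0) ^ 2 + (B 1 - A 1) ^ 2 ≠ 0 := by
    rw [← ae_dist]
    exact pow_ne_zero _ (dist_ne_zero.2 hBA')
  by_cases hD : (B 0 - A 0) * (C 1 - A 1) - (B 1 - A 1) * (C 0 - A 0) = 0
  · refine ⟨((C 0 - A 0) * (B 0 - A 0) + (C 1 - A 1) * (B 1 - A 1)) /
      ((B 0 - A 0) ^ 2 + (B 1 - A 1) ^ 2), ?_⟩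
    ext i
    fin_cases i
    · simp
      field_simp
      linear_combination -(B 1 - A 1) * hD
    · simp
      field_simp
      linear_combination (B 0 - A 0) * hD
  · exfalso
    obtain ⟨m, hm⟩ := hS A hA B hB
    obtain ⟨n, hn'⟩ := hS A hA C hC
    apply hinf
    refine Set.Finite.subset (Set.Finite.biUnion (Set.finite_Icc (-m) m) fun k _ =>
      Set.Finite.biUnion (Set.finite_Icc (-n) n) fun l _ =>
        ae_fin2 A B C (k : ℝ) (l : ℝ) hD) ?_
    intro P hP
    obtain ⟨a, ha⟩ := hS P hP A hA
    obtain ⟨b, hb⟩ := hS P hP B hB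
    obtain ⟨c, hc⟩ := hS P hP C hC
    have t1 := abs_le.1 (abs_dist_sub_le A B P)
    have t2 := abs_le.1 (abs_dist_sub_le A C P)
    rw [dist_comm A P, dist_comm B P, ha, hb, hm] at t1
    rw [dist_comm A P, dist_comm C P, ha, hc, hn'] at t2
    simp only [Set.mem_iUnion]
    refine ⟨a - b, ?_, a - c, ?_, ?_, ?_⟩
    · exact ⟨by exact_mod_cast t1.1, by exact_mod_cast t1.2⟩
    · exact ⟨by exact_mod_cast t2.1, by exact_mod_cast t2.2⟩
    · rw [ha, hb]; push_cast; rfl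
    · rw [ha, hc]; push_cast; rfl
end

section
/- There exists a subset S of the unit circle {(x, y) ∈ ℝ² : x² + y² = 1} such that S is dense in the unit circle (with respect to the Euclidean topology) and the Euclidean distance between any two points of S is a rational number. -/
/-- Parametrization of the unit circle. -/
noncomputable def circPt (t : ℝ) : EuclideanSpace ℝ (Fin 2) :=
  !₂[((1 - t ^ 2) / (1 + t ^ 2)) ^ 2 - (2 * t / (1 + t ^ 2)) ^ 2,
    2 * ((1 - t ^ 2) / (1 + t ^ 2)) * (2 * t / (1 + t ^ 2))]

theorem circPt_continuous : Continuous circPt := by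
  have h : ∀ t : ℝ, 1 + t ^ 2 ≠ 0 := fun t => by positivity
  unfold circPt
  apply (PiLp.continuous_toLp 2 _).comp
  refine continuous_pi fun i => ?_
  fin_cases i
  · simp only [Fin.zero_eta, Matrix.cons_val_zero]
    fun_prop (disch := exact h _)
  · simp only [Fin.mk_one, Matrix.cons_val_one, Matrix.cons_val_zero]
    fun_prop (disch := exact h _)

theorem circPt_mem (t : ℝ) : circPt t ∈ Metric.sphere (0 : EuclideanSpace ℝ (Fin 2)) 1 := by
  have h : 1 + t ^ 2 ≠ 0 := by positivity
  rw [mem_sphere_zero_iff_norm, EuclideanSpace.norm_eq, Real.sqrt_eq_one]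
  simp only [circPt, Fin.sum_univ_two, Real.norm_eq_abs, sq_abs]
  simp
  field_simp
  ring

theorem circPt_surj (p : EuclideanSpace ℝ (Fin 2))
    (hp : p ∈ Metric.sphere (0 : EuclideanSpace ℝ (Fin 2)) 1) : ∃ t, circPt t = p := by
  rw [mem_sphere_zero_iff_norm, EuclideanSpace.norm_eq, Real.sqrt_eq_one] at hp
  simp only [Fin.sum_univ_two, Real.norm_eq_abs, sq_abs] at hp
  set z : ℂ := ⟨p 0, p 1⟩ with hz
  have hn : ‖z‖ = 1 := by
    rw [Complex.norm_def, Real.sqrt_eq_one, Complex.normSq_apply]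
    simp only [hz]; linarith
  have h1 := Complex.norm_mul_cos_arg z
  have h2 := Complex.norm_mul_sin_arg z
  rw [hn, one_mul] at h1 h2
  have h3 := Complex.neg_pi_lt_arg z
  have h4 := Complex.arg_le_pi z
  obtain ⟨b, hb⟩ : ∃ b, z.arg = 2 * (2 * b) := ⟨z.arg / 4, by ring⟩
  have hC : 0 < Real.cos b := by
    apply Real.cos_pos_of_mem_Ioo
    constructor <;> linarith [Real.pi_pos]
  have hCS := Real.sin_sq_add_cos_sq b
  rw [hb, Real.cos_two_mul', Real.cos_two_mul', Real.sin_two_mul] at h1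
  rw [hb, Real.sin_two_mul, Real.cos_two_mul', Real.sin_two_mul] at h2
  have e1 : (1 - (Real.sin b / Real.cos b) ^ 2) / (1 + (Real.sin b / Real.cos b) ^ 2)
      = Real.cos b ^ 2 - Real.sin b ^ 2 := by
    have : 1 + (Real.sin b / Real.cos b) ^ 2 = 1 / Real.cos b ^ 2 := by
      field_simp; linarith
    rw [this]; field_simp
  have e2 : 2 * (Real.sin b / Real.cos b) / (1 + (Real.sin b / Real.cos b) ^ 2)
      = 2 * Real.sin b * Real.cos b := by
    have : 1 + (Real.sin b / Real.cos b) ^ 2 = 1 / Real.cos b ^ 2 := by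
      field_simp; linarith
    rw [this]; field_simp
  refine ⟨Real.sin b / Real.cos b, ?_⟩
  unfold circPt
  rw [e1, e2]
  ext i
  fin_cases i
  · simpa using h1
  · simp only [hz] at h2
    simp
    linarith

theorem circPt_dist (s t : ℝ) : dist (circPt s) (circPt t) =
    |2 * ((1 - s ^ 2) / (1 + s ^ 2) * (2 * t / (1 + t ^ 2))
      - (1 - t ^ 2) / (1 + t ^ 2) * (2 * s / (1 + s ^ 2)))| := by
  have h : 1 + t ^ 2 ≠ 0 := by positivity
  have h' : 1 + s ^ 2 ≠ 0 := by positivity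
  rw [EuclideanSpace.dist_eq, ← Real.sqrt_sq_eq_abs]
  congr 1
  simp only [circPt, Fin.sum_univ_two, Real.dist_eq, sq_abs]
  simp
  have a : ((1 - s ^ 2) / (1 + s ^ 2)) ^ 2 + (2 * s / (1 + s ^ 2)) ^ 2 = 1 := by
    field_simp; ring
  have b : ((1 - t ^ 2) / (1 + t ^ 2)) ^ 2 + (2 * t / (1 + t ^ 2)) ^ 2 = 1 := by
    field_simp; ring
  generalize (1 - s ^ 2) / (1 + s ^ 2) = c at *
  generalize (2 * s / (1 + s ^ 2)) = d at *
  generalize (1 - t ^ 2) / (1 + t ^ 2) = e at *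
  generalize (2 * t / (1 + t ^ 2)) = f at *
  have hd : d ^ 2 = 1 - c ^ 2 := by linarith
  have hf : f ^ 2 = 1 - e ^ 2 := by linarith
  grind

/-- There is a dense subset of the unit circle all of whose pairwise Euclidean
distances are rational. -/
theorem exists_dense_rational_set_on_unit_circle :
    ∃ S : Set (EuclideanSpace ℝ (Fin 2)),
      S ⊆ Metric.sphere (0 : EuclideanSpace ℝ (Fin 2)) 1 ∧
      Metric.sphere (0 : EuclideanSpace ℝ (Fin 2)) 1 ⊆ closure S ∧
      ∀ p ∈ S, ∀ q ∈ S, ∃ d : ℚ, dist p q = (d : ℝ) := by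
  refine ⟨circPt '' Set.range ((↑) : ℚ → ℝ), ?_, ?_, ?_⟩
  · rintro _ ⟨t, -, rfl⟩
    exact circPt_mem t
  · intro p hp
    obtain ⟨t, rfl⟩ := circPt_surj p hp
    exact image_closure_subset_closure_image circPt_continuous
      ⟨t, Rat.denseRange_cast (𝕜 := ℝ) t, rfl⟩
  · rintro _ ⟨_, ⟨s, rfl⟩, rfl⟩ _ ⟨_, ⟨t, rfl⟩, rfl⟩
    refine ⟨|2 * ((1 - s ^ 2) / (1 + s ^ 2) * (2 * t / (1 + t ^ 2))
      - (1 - t ^ 2) / (1 + t ^ 2) * (2 * s / (1 + s ^ 2)))|, ?_⟩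
    rw [circPt_dist]
    push_cast
    rfl
end
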